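/- arXiv:1807.08579 — 8 statements merged into one kernel-verified Lean document; each statement's English description precedes it below -/
import Mathlib

section
/- Let τ = {τ_1,…,τ_n} (n ≥ 1) be a finite set of constrained-deadline sporadic tasks with positive real parameters such that dbf(τ,t) ≤ t for all t > 0, and let d = max_{1≤i≤n} d_i be the largest relative deadline. Then dbf*(τ, d) ≤ (14/9)·d. -/
open Finset

/-- Demand bound function of a task `(e, d, p)` at time `t`. -/
noncomputable def dbf (e d p t : ℝ) : ℝ :=
  if t < d then 0 else ((⌊(t - d) / p⌋ : ℝ) + 1) * e

/-- Approximate demand bound function of a task `(e, d, p)` at time `t`. -/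
noncomputable def dbfStar (e d p t : ℝ) : ℝ :=
  if t < d then 0 else ((t - d) / p + 1) * e

/-- Modified demand function `f` of a task `(e, d, p)` at time `t`. -/
noncomputable def fmod (e d p t : ℝ) : ℝ :=
  if t < d + p then dbf e d p t else 2 * e

/-- Number of jobs of a task `(d, p)` whose deadline is at most `t`. -/
noncomputable def jobs (d p t : ℝ) : ℝ :=
  if t < d then 0 else (⌊(t - d) / p⌋ : ℝ) + 1

/-- Indicator function of `[x, ∞)`. -/
noncomputable def step (x t : ℝ) : ℝ :=
  if x ≤ t then 1 else 0

/-- Integral of a demand curve against the measure with an atom `1 / 2` at `1`, density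
`1 / (2 - t) ^ 2` on `[0, 1]` and density `1 / t ^ 2` on `[1, 2]`. -/
noncomputable def weightedDemand (φ : ℝ → ℝ) : ℝ :=
  φ 1 / 2 + (∫ t in (0 : ℝ)..1, φ t * (1 / (2 - t) ^ 2)) + ∫ t in (1 : ℝ)..2, φ t * (1 / t ^ 2)

/-- Mass of `[x, ∞)` under the density `1 / t ^ 2` on `[1, 2]`. -/
noncomputable def lateMass (x : ℝ) : ℝ :=
  ∫ t in (1 : ℝ)..2, step x t * (1 / t ^ 2)

theorem step_monotone (x : ℝ) : Monotone (step x) := by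
  intro s t hst
  unfold step
  split_ifs with h₁ h₂
  · rfl
  · exact absurd (h₁.trans hst) h₂
  · exact zero_le_one
  · rfl

theorem step_nonneg (x t : ℝ) : 0 ≤ step x t := by
  unfold step
  split_ifs <;> norm_num

theorem jobs_monotone {d p : ℝ} (hp : 0 < p) : Monotone (jobs d p) := by
  intro s t hst
  unfold jobs
  split_ifs with h₁ h₂ h₂
  · rfl
  · have : (0 : ℝ) ≤ ⌊(t - d) / p⌋ := by
      exact_mod_cast Int.floor_nonneg.2 (div_nonneg (by linarith) hp.le)
    linarith
  · linarith
  · gcongr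

theorem sum_step_le_jobs {d p : ℝ} (hp : 0 < p) (n : ℕ) (t : ℝ) :
    ∑ j ∈ range n, step (d + j * p) t ≤ jobs d p t := by
  unfold jobs
  split_ifs with h
  · refine Finset.sum_nonpos fun j _ => ?_
    have : 0 ≤ (j : ℝ) * p := by positivity
    rw [step, if_neg (by linarith)]
  · have h0 : 0 ≤ (t - d) / p := div_nonneg (by linarith) hp.le
    have hsub : (range n).filter (fun j : ℕ => d + j * p ≤ t) ⊆ range (⌊(t - d) / p⌋₊ + 1) := by
      intro j hj
      rw [Finset.mem_filter] at hj
      rw [Finset.mem_range, Nat.lt_succ_iff]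
      exact Nat.le_floor ((le_div_iff₀ hp).2 (by linarith [hj.2]))
    have hcard := Finset.card_le_card hsub
    rw [Finset.card_range] at hcard
    simp only [step]
    rw [Finset.sum_boole, ← natCast_floor_eq_intCast_floor h0]
    exact_mod_cast hcard

theorem add_one_le_jobs {d p : ℝ} (hp : 0 < p) {m : ℕ} {t : ℝ} (h : d + m * p ≤ t) :
    (m : ℝ) + 1 ≤ jobs d p t := by
  refine le_trans (le_of_eq ?_) (sum_step_le_jobs hp (m + 1) t)
  rw [Finset.sum_congr rfl (g := fun _ => (1 : ℝ))]
  · simp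
  · intro j hj
    have : (j : ℝ) ≤ m := by exact_mod_cast Nat.lt_succ_iff.1 (Finset.mem_range.1 hj)
    refine if_pos (le_trans ?_ h)
    gcongr

theorem div_le_jobs {d p t : ℝ} (h : d ≤ t) : (t - d) / p ≤ jobs d p t := by
  rw [jobs, if_neg h.not_gt]
  exact (Int.lt_floor_add_one _).le

theorem jobs_div_div (d p t : ℝ) {D : ℝ} (hD : 0 < D) :
    jobs (d / D) (p / D) t = jobs d p (D * t) := by
  unfold jobs
  have h₁ : t < d / D ↔ D * t < d := by rw [lt_div_iff₀ hD, mul_comm]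
  have h₂ : (t - d / D) / (p / D) = (D * t - d) / p := by
    rw [← mul_div_mul_left _ (p / D) hD.ne', mul_sub, mul_div_cancel₀ d hD.ne',
      mul_div_cancel₀ p hD.ne']
  rw [h₂]
  simp only [h₁]

theorem dbf_eq_jobs_mul (e d p t : ℝ) : dbf e d p t = jobs d p t * e := by
  unfold dbf jobs
  split_ifs <;> simp

section Integrals

variable {a b : ℝ} {f : ℝ → ℝ}

theorem Monotone.intervalIntegrable_mul {φ : ℝ → ℝ} (hφ : Monotone φ)
    (hf : ContinuousOn f (Set.uIcc a b)) :
    IntervalIntegrable (fun t => φ t * f t) MeasureTheory.volume a b :=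
  hφ.intervalIntegrable.mul_continuousOn hf

theorem integral_step_mul {x : ℝ} (hx : x ∈ Set.Icc a b) (hf : ContinuousOn f (Set.uIcc a b)) :
    ∫ t in a..b, step x t * f t = ∫ t in x..b, f t := by
  have hxu : x ∈ Set.uIcc a b := Set.Icc_subset_uIcc hx
  have hint := (step_monotone x).intervalIntegrable_mul hf
  rw [← intervalIntegral.integral_add_adjacent_intervals
    (hint.mono_set (Set.uIcc_subset_uIcc_left hxu))
    (hint.mono_set (Set.uIcc_subset_uIcc_right hxu)),
    intervalIntegral.integral_congr_Ioo_of_le hx.1 (g := fun _ => 0),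
    intervalIntegral.integral_congr_Ioo_of_le hx.2 (g := f)]
  · simp
  · intro t ht
    simp [step, ht.1.le]
  · intro t ht
    simp [step, ht.2]

theorem integral_step_mul_nonneg (hab : a ≤ b) (x : ℝ) (hf : ∀ t, 0 ≤ f t) :
    0 ≤ ∫ t in a..b, step x t * f t :=
  intervalIntegral.integral_nonneg hab fun t _ => mul_nonneg (step_nonneg x t) (hf t)

theorem sum_integral_step_le {d p : ℝ} (hp : 0 < p) (n : ℕ) (hab : a ≤ b)
    (hf : ContinuousOn f (Set.uIcc a b)) (hf₀ : ∀ t, 0 ≤ f t) :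
    ∑ j ∈ range n, ∫ t in a..b, step (d + j * p) t * f t ≤ ∫ t in a..b, jobs d p t * f t := by
  rw [← intervalIntegral.integral_finsetSum
    fun (j : ℕ) _ => (step_monotone (d + j * p)).intervalIntegrable_mul hf]
  have hsum : IntervalIntegrable (fun t => ∑ j ∈ range n, step (d + j * p) t * f t)
      MeasureTheory.volume a b := by
    simpa only [← Finset.sum_fn] using IntervalIntegrable.sum (range n)
      fun (j : ℕ) _ => (step_monotone (d + j * p)).intervalIntegrable_mul hf
  refine intervalIntegral.integral_mono_on hab hsum
    ((jobs_monotone hp).intervalIntegrable_mul hf) fun t _ => ?_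
  rw [← Finset.sum_mul]
  exact mul_le_mul_of_nonneg_right (sum_step_le_jobs hp n t) (hf₀ t)

end Integrals

theorem continuousOn_earlyWeight :
    ContinuousOn (fun t : ℝ => 1 / (2 - t) ^ 2) (Set.uIcc 0 1) := by
  rw [Set.uIcc_of_le zero_le_one]
  refine ContinuousOn.div (by fun_prop) (by fun_prop) fun t ht => ?_
  have : 0 < 2 - t := by linarith [ht.2]
  positivity

theorem continuousOn_lateWeight :
    ContinuousOn (fun t : ℝ => 1 / t ^ 2) (Set.uIcc 1 2) := by
  rw [Set.uIcc_of_le one_le_two]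
  refine ContinuousOn.div (by fun_prop) (by fun_prop) fun t ht => ?_
  have : 0 < t := by linarith [ht.1]
  positivity

theorem integral_step_earlyWeight {x : ℝ} (hx₀ : 0 ≤ x) (hx₁ : x ≤ 1) :
    ∫ t in (0 : ℝ)..1, step x t * (1 / (2 - t) ^ 2) = (1 - x) / (2 - x) := by
  rw [integral_step_mul ⟨hx₀, hx₁⟩ continuousOn_earlyWeight,
    intervalIntegral.integral_eq_sub_of_hasDerivAt (f := fun t => 1 / (2 - t))]
  · have : 2 - x ≠ 0 := by linarith
    field_simp
    ring
  · intro t ht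
    rw [Set.uIcc_of_le hx₁] at ht
    have : 2 - t ≠ 0 := by linarith [ht.2]
    simpa using ((hasDerivAt_id t).const_sub 2).fun_inv this
  · exact (continuousOn_earlyWeight.mono
      (Set.uIcc_subset_uIcc_right (Set.Icc_subset_uIcc ⟨hx₀, hx₁⟩))).intervalIntegrable

theorem integral_lateWeight {x : ℝ} (hx₁ : 1 ≤ x) (hx₂ : x ≤ 2) :
    ∫ t in x..2, 1 / t ^ 2 = 1 / x - 1 / 2 := by
  rw [intervalIntegral.integral_eq_sub_of_hasDerivAt (f := fun t => -(1 / t))]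
  · ring
  · intro t ht
    rw [Set.uIcc_of_le hx₂] at ht
    have : t ≠ 0 := by linarith [ht.1]
    simpa using (hasDerivAt_inv this).fun_neg
  · exact (continuousOn_lateWeight.mono
      (Set.uIcc_subset_uIcc_right (Set.Icc_subset_uIcc ⟨hx₁, hx₂⟩))).intervalIntegrable

theorem lateMass_nonneg (x : ℝ) : 0 ≤ lateMass x :=
  integral_step_mul_nonneg one_le_two x fun t => by positivity

theorem lateMass_eq {x : ℝ} (hx₁ : 1 ≤ x) (hx₂ : x ≤ 2) : lateMass x = 1 / x - 1 / 2 := by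
  rw [lateMass, integral_step_mul ⟨hx₁, hx₂⟩ continuousOn_lateWeight, integral_lateWeight hx₁ hx₂]

theorem lateMass_of_le_one {x : ℝ} (hx : x ≤ 1) : lateMass x = 1 / 2 := by
  rw [lateMass, intervalIntegral.integral_congr_Ioo_of_le one_le_two (g := fun t => 1 / t ^ 2),
    integral_lateWeight le_rfl one_le_two]
  · norm_num
  · intro t ht
    simp [step, hx.trans ht.1.le]

theorem weightedDemand_id : weightedDemand (fun t => t) = 3 / 2 := by
  have early : ∫ t in (0 : ℝ)..1, t * (1 / (2 - t) ^ 2) = 1 - Real.log 2 := by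
    rw [intervalIntegral.integral_eq_sub_of_hasDerivAt
      (f := fun t => 2 * (1 / (2 - t)) + Real.log (2 - t))]
    · norm_num
      ring
    · intro t ht
      rw [Set.uIcc_of_le zero_le_one] at ht
      have h : 2 - t ≠ 0 := by linarith [ht.2]
      have hsub := (hasDerivAt_id' t).const_sub 2
      have := ((hsub.fun_inv h).const_mul 2).fun_add (hsub.log h)
      simp only [one_div]
      convert this using 1
      field_simp
      ring
    · exact (continuousOn_id.mul continuousOn_earlyWeight).intervalIntegrable
  have late : ∫ t in (1 : ℝ)..2, t * (1 / t ^ 2) = Real.log 2 := by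
    rw [intervalIntegral.integral_congr_Ioo_of_le one_le_two (g := fun t => 1 / t),
      integral_one_div_of_pos one_pos two_pos]
    · norm_num
    · intro t ht
      have : t ≠ 0 := by linarith [ht.1]
      simp only
      field_simp
  rw [weightedDemand, early, late]
  ring

theorem weightedDemand_mono {φ ψ : ℝ → ℝ} (hφ : Monotone φ) (hψ : Monotone ψ)
    (h : ∀ t, 0 ≤ t → φ t ≤ ψ t) : weightedDemand φ ≤ weightedDemand ψ := by
  unfold weightedDemand
  gcongr ?_ / 2 + ?_ + ?_
  · exact h 1 zero_le_one
  · exact intervalIntegral.integral_mono_on zero_le_one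
      (hφ.intervalIntegrable_mul continuousOn_earlyWeight)
      (hψ.intervalIntegrable_mul continuousOn_earlyWeight)
      fun t ht => mul_le_mul_of_nonneg_right (h t ht.1) (by positivity)
  · exact intervalIntegral.integral_mono_on one_le_two
      (hφ.intervalIntegrable_mul continuousOn_lateWeight)
      (hψ.intervalIntegrable_mul continuousOn_lateWeight)
      fun t ht => mul_le_mul_of_nonneg_right (h t (by linarith [ht.1])) (by positivity)

theorem weightedDemand_sum {ι : Type*} (s : Finset ι) (φ : ι → ℝ → ℝ) (c : ι → ℝ)
    (hφ : ∀ i ∈ s, Monotone (φ i)) :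
    weightedDemand (fun t => ∑ i ∈ s, φ i t * c i) = ∑ i ∈ s, weightedDemand (φ i) * c i := by
  have key {a b : ℝ} {f : ℝ → ℝ} (hf : ContinuousOn f (Set.uIcc a b)) :
      ∫ t in a..b, (∑ i ∈ s, φ i t * c i) * f t = ∑ i ∈ s, (∫ t in a..b, φ i t * f t) * c i := by
    simp_rw [← intervalIntegral.integral_mul_const, Finset.sum_mul]
    rw [← intervalIntegral.integral_finsetSum
      fun i hi => ((hφ i hi).intervalIntegrable_mul hf).mul_const (c i)]
    simp only [mul_right_comm]
  simp only [weightedDemand]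
  rw [key continuousOn_earlyWeight, key continuousOn_lateWeight, Finset.sum_div,
    ← Finset.sum_add_distrib, ← Finset.sum_add_distrib]
  refine Finset.sum_congr rfl fun i _ => ?_
  ring

theorem sum_earlyWeight_le {d p : ℝ} (hd : 0 < d) (hp : 0 < p) {n : ℕ}
    (h : ∀ j < n, d + j * p ≤ 1) :
    ∑ j ∈ range n, (1 - (d + j * p)) / (2 - (d + j * p)) ≤
      ∫ t in (0 : ℝ)..1, jobs d p t * (1 / (2 - t) ^ 2) := by
  refine le_trans (le_of_eq (Finset.sum_congr rfl fun j hj => ?_))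
    (sum_integral_step_le hp n zero_le_one continuousOn_earlyWeight fun t => by positivity)
  exact (integral_step_earlyWeight (by positivity) (h j (Finset.mem_range.1 hj))).symm

theorem add_sum_lateWeight_le {d p : ℝ} (hp : 0 < p) {m : ℕ} (h : d + m * p ≤ 1) (n : ℕ) :
    ((m : ℝ) + 1) / 2 + ∑ j ∈ range n, lateMass (d + ((m + 1 + j : ℕ) : ℝ) * p) ≤
      ∫ t in (1 : ℝ)..2, jobs d p t * (1 / t ^ 2) := by
  refine le_trans (le_of_eq ?_) (sum_integral_step_le hp (m + 1 + n) one_le_two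
    continuousOn_lateWeight fun t => by positivity)
  rw [Finset.sum_range_add, Finset.sum_congr (s₁ := range (m + 1)) rfl (g := fun _ => (1 / 2 : ℝ))]
  · simp [div_eq_mul_inv, lateMass]
  · intro j hj
    have : (j : ℝ) ≤ m := by exact_mod_cast Nat.lt_succ_iff.1 (Finset.mem_range.1 hj)
    refine lateMass_of_le_one (le_trans ?_ h)
    gcongr

theorem div_le_one_early_two_late {d p : ℝ} (hd : 0 < d) (hdp : d ≤ p)
    (h2 : 1 ≤ d + p) (h3 : d + 2 * p ≤ 2) :
    (1 - d) / p ≤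
      (1 - d) / (2 - d) + (1 / (d + p) - 1 / 2) + (1 / (d + 2 * p) - 1 / 2) + 1 / 18 / p := by
  obtain ⟨a, rfl⟩ : ∃ a, p = 1 - d + a := ⟨p - 1 + d, by ring⟩
  have ha : 0 ≤ a := by linarith
  have hp : 0 < 1 - d + a := hd.trans_le hdp
  have hd' : 0 < 2 - d := by linarith
  have ha' : a ≤ d / 2 := by linarith
  rw [← sub_nonneg]
  have hfactor : (1 - d) / (2 - d) + (1 / (d + (1 - d + a)) - 1 / 2) +
        (1 / (d + 2 * (1 - d + a)) - 1 / 2) + 1 / 18 / (1 - d + a) - (1 - d) / (1 - d + a) =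
      (1 / 18 - a * (1 - (d * (2 - d) / (1 + a) + d / (2 - d + 2 * a))) / (2 - d)) /
        (1 - d + a) := by
    rw [show d + (1 - d + a) = 1 + a by ring, show d + 2 * (1 - d + a) = 2 - d + 2 * a by ring]
    have : 2 - d + 2 * a ≠ 0 := by linarith
    field_simp
    ring
  rw [hfactor]
  refine div_nonneg (sub_nonneg.2 ?_) hp.le
  rw [div_le_iff₀ hd']
  have e1 : d * (2 - d) / (1 + d / 2) ≤ d * (2 - d) / (1 + a) := by gcongr
  have e2 : d / 2 ≤ d / (2 - d + 2 * a) := by gcongr; linarith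
  have e3 : d / 2 * (1 - (d * (2 - d) / (1 + d / 2) + d / 2)) ≤ 1 / 18 * (2 - d) := by
    have : d / 2 * (1 - (d * (2 - d) / (1 + d / 2) + d / 2)) =
        d / 4 * (1 - 3 * d / 2) / (1 + d / 2) * (2 - d) := by
      field_simp
      ring
    rw [this]
    refine mul_le_mul_of_nonneg_right ?_ hd'.le
    rw [div_le_iff₀ (by positivity)]
    nlinarith [sq_nonneg (d - 8 / 27)]
  rcases le_total 0 (1 - (d * (2 - d) / (1 + a) + d / (2 - d + 2 * a))) with h | h
  · refine le_trans ?_ e3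
    gcongr
  · exact (mul_nonpos_of_nonneg_of_nonpos ha h).trans (by positivity)

theorem div_le_one_early_one_late {d p : ℝ} (hd : 0 < d) (h1 : d ≤ 1)
    (h3 : 2 ≤ d + 2 * p) (h4 : d + p ≤ 2) :
    (1 - d) / p ≤ (1 - d) / (2 - d) + (1 / (d + p) - 1 / 2) + 1 / 18 / p := by
  have hp : 0 < p := by linarith
  have hd' : 0 < 2 - d := by linarith
  obtain ⟨q, hq⟩ : ∃ q, q = 2 - d - p := ⟨_, rfl⟩
  obtain rfl : p = 2 - d - q := by linarith
  have key : 9 * (q * d * (q - d)) ≤ (2 - q) * (2 - d) := by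
    have hq0 : 0 ≤ q := by linarith
    have hq1 : 0 ≤ 1 - d / 2 - q := by linarith
    rcases le_total q d with h | h
    · nlinarith [mul_nonneg (mul_nonneg hq0 hd.le) (sub_nonneg.2 h), mul_nonneg hq1 hd'.le]
    · have e1 : q * d * (q - d) ≤ (1 - d / 2) * d * (1 - 3 * d / 2) := by
        refine mul_le_mul ?_ (by linarith) (by linarith) (by nlinarith)
        exact mul_le_mul_of_nonneg_right (by linarith) hd.le
      have e2 : 9 * ((1 - d / 2) * d * (1 - 3 * d / 2)) ≤ (1 + d / 2) * (2 - d) := by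
        nlinarith [mul_nonneg hd'.le (sq_nonneg (d - 8 / 27))]
      have e3 : (1 + d / 2) * (2 - d) ≤ (2 - q) * (2 - d) := by gcongr; linarith
      linarith
  rw [← sub_nonneg]
  have : (1 - d) / (2 - d) + (1 / (d + (2 - d - q)) - 1 / 2) +
      1 / 18 / (2 - d - q) - (1 - d) / (2 - d - q) =
      ((2 - q) * (2 - d) - 9 * (q * d * (q - d))) / (18 * (2 - d - q) * (2 - d) * (2 - q)) := by
    rw [show d + (2 - d - q) = 2 - q by ring]
    have : 2 - q ≠ 0 := by linarith
    field_simp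
    ring
  rw [this]
  have : 0 < 2 - q := by linarith
  exact div_nonneg (by linarith) (by positivity)

theorem div_le_two_early_one_late {d p : ℝ} (hd : 0 < d) (hdp : d ≤ p)
    (h1 : d + p ≤ 1) (h2 : 1 ≤ d + 2 * p) :
    (1 - d - p) / p ≤ (1 - d) / (2 - d) + (1 - (d + p)) / (2 - (d + p)) + (1 / (d + 2 * p) - 1 / 2) := by
  have hp : 0 < p := by linarith
  have e1 : 2 - (d + 2 * p) ≤ 1 / (d + 2 * p) := by
    rw [le_div_iff₀ (by linarith)]; nlinarith [sq_nonneg (d + 2 * p - 1)]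
  have e2 : 1 / 6 + (1 - d) / 3 ≤ (1 - d) / (2 - d) := by
    rw [le_div_iff₀ (by linarith)]; nlinarith
  have e3 : 2 * (1 - (d + p)) / 3 ≤ (1 - (d + p)) / (2 - (d + p)) := by
    rw [le_div_iff₀ (by linarith)]; nlinarith
  rw [div_le_iff₀ hp]
  have : 1 - d - p ≤ (1 / 6 + (1 - d) / 3 + 2 * (1 - (d + p)) / 3 + (2 - (d + 2 * p) - 1 / 2)) * p := by
    nlinarith
  have := mul_le_mul_of_nonneg_right (add_le_add (add_le_add e2 e3) (sub_le_sub_right e1 (1 / 2))) hp.le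
  linarith

theorem div_le_three_early {d p s : ℝ} (hd : 0 < d) (hdp : d ≤ p)
    (h1 : d + 2 * p ≤ 1) (h2 : s ≤ p) (h3 : s ≤ 1 - d - 2 * p) :
    s / p ≤ (1 - d) / (2 - d) + (1 - (d + p)) / (2 - (d + p)) +
      (1 - (d + 2 * p)) / (2 - (d + 2 * p)) + 1 / 18 / p := by
  have hp : 0 < p := by linarith
  have tangent (c x : ℝ) (hc : 0 < 1 + c) (hx : x ≤ 1) :
      (1 - x) * ((1 + 2 * c - (1 - x)) / (1 + c) ^ 2) ≤ (1 - x) / (2 - x) := by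
    rw [div_eq_mul_one_div (1 - x) (2 - x)]
    refine mul_le_mul_of_nonneg_left ?_ (by linarith)
    rw [div_le_div_iff₀ (by positivity) (by linarith)]
    nlinarith [sq_nonneg (1 - x - c)]
  have e1 := tangent (1 / 4) (d + 2 * p) (by norm_num) h1
  have e2 := tangent (1 / 2) (d + p) (by norm_num) (by linarith)
  have e3 := tangent (3 / 4) d (by norm_num) (by linarith)
  rw [← sub_le_iff_le_add, ← sub_div]
  refine le_trans ?_ (add_le_add (add_le_add e3 e2) e1)
  rw [div_le_iff₀ hp]
  norm_num
  rcases le_total p (1 - d - 2 * p) with h | h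
  · have : 5 / 6 ≤ (1 - d) * ((5 / 2 - (1 - d)) / (49 / 16)) +
        (1 - (d + p)) * ((2 - (1 - (d + p))) / (9 / 4)) +
        (1 - (d + 2 * p)) * ((3 / 2 - (1 - (d + 2 * p))) / (25 / 16)) := by
      nlinarith
    nlinarith
  · have : 4 * (1 - d - 2 * p) - 2 / 9 ≤ (1 - d) * ((5 / 2 - (1 - d)) / (49 / 16)) +
        (1 - (d + p)) * ((2 - (1 - (d + p))) / (9 / 4)) +
        (1 - (d + 2 * p)) * ((3 / 2 - (1 - (d + 2 * p))) / (25 / 16)) := by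
      nlinarith
    have : 0 ≤ (1 - d) * ((5 / 2 - (1 - d)) / (49 / 16)) +
        (1 - (d + p)) * ((2 - (1 - (d + p))) / (9 / 4)) +
        (1 - (d + 2 * p)) * ((3 / 2 - (1 - (d + 2 * p))) / (25 / 16)) := by
      nlinarith
    nlinarith

/-- A single task with unit execution time satisfies the dual constraint. -/
theorem one_add_div_le_weightedDemand {d p : ℝ} (hd : 0 < d) (hd₁ : d ≤ 1) (hdp : d ≤ p) :
    (1 - d) / p + 1 ≤ weightedDemand (jobs d p) + 1 / 18 / p := by
  have hp : 0 < p := hd.trans_le hdp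
  have hu : 0 ≤ 1 / 18 / p := by positivity
  obtain ⟨m, hm⟩ : ∃ m, m = ⌊(1 - d) / p⌋₊ := ⟨_, rfl⟩
  have hle : d + m * p ≤ 1 := by
    have := Nat.floor_le (div_nonneg (sub_nonneg.2 hd₁) hp.le)
    rw [← hm, le_div_iff₀ hp] at this
    linarith
  have hlt : 1 < d + (m + 1) * p := by
    have := Nat.lt_floor_add_one ((1 - d) / p)
    rw [← hm, div_lt_iff₀ hp] at this
    linarith
  have hatom := add_one_le_jobs hp hle
  have hlate := add_sum_lateWeight_le hp hle 2
  have hearly {n : ℕ} (hn : n ≤ m + 1) := sum_earlyWeight_le (n := n) hd hp fun j hj => by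
    have : (j : ℝ) ≤ m := by exact_mod_cast Nat.lt_succ_iff.1 (hj.trans_le hn)
    exact le_trans (by gcongr) hle
  unfold weightedDemand
  generalize (∫ t in (0 : ℝ)..1, jobs d p t * (1 / (2 - t) ^ 2)) = early at hearly ⊢
  generalize (∫ t in (1 : ℝ)..2, jobs d p t * (1 / t ^ 2)) = late at hlate ⊢
  match m with
  | 0 =>
    have hearly := hearly (n := 1) le_rfl
    simp only [Finset.sum_range_succ, Finset.sum_range_zero] at hearly hlate
    norm_num at hearly hlate hatom hlt
    have hmass₁ := lateMass_nonneg (d + p)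
    have hmass₂ := lateMass_nonneg (d + 2 * p)
    rcases le_total (d + 2 * p) 2 with h₂ | h₂
    · rw [lateMass_eq hlt.le (by linarith), lateMass_eq (by linarith) h₂] at hlate
      linarith [div_le_one_early_two_late hd hdp hlt.le h₂]
    · rcases le_total (d + p) 2 with h₁ | h₁
      · rw [lateMass_eq hlt.le h₁] at hlate
        linarith [div_le_one_early_one_late hd hd₁ h₂ h₁]
      · have : (1 - d) / p ≤ (1 - d) / (2 - d) := by gcongr <;> linarith
        linarith
  | 1 =>
    have hearly := hearly (n := 2) le_rfl
    simp only [Finset.sum_range_succ, Finset.sum_range_zero] at hearly hlate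
    norm_num at hearly hlate hatom hlt hle
    have hsplit : (1 - d) / p = (1 - d - p) / p + 1 := by field_simp; ring
    have hbound := div_le_two_early_one_late hd hdp hle hlt.le
    have hmass := lateMass_nonneg (d + 3 * p)
    rw [lateMass_eq hlt.le (by linarith)] at hlate
    linarith
  | m + 2 =>
    have hearly := hearly (n := 3) (by omega)
    simp only [Finset.sum_range_succ, Finset.sum_range_zero] at hearly hlate
    norm_num at hearly hlate hatom hlt hle
    have hmp : 0 ≤ m * p := by positivity
    have hsplit : (1 - d) / p = (1 - d - (m + 2) * p) / p + (m + 2) := by field_simp; ring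
    have hbound := div_le_three_early (s := 1 - d - (m + 2) * p) hd hdp (by linarith)
      (by linarith) (by linarith)
    have hmass₁ := lateMass_nonneg (d + (m + 2 + 1) * p)
    have hmass₂ := lateMass_nonneg (d + (m + 2 + 1 + 1) * p)
    linarith

/-- Long-run utilization is at most one. -/
theorem sum_div_le_one {ι : Type*} (s : Finset ι) (e d p : ι → ℝ) {D : ℝ} (hD : 0 < D)
    (he : ∀ i ∈ s, 0 ≤ e i) (hd : ∀ i ∈ s, d i ≤ D)
    (h : ∀ t, 0 < t → ∑ i ∈ s, jobs (d i) (p i) t * e i ≤ t) :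
    ∑ i ∈ s, e i / p i ≤ 1 := by
  by_contra! hU
  obtain ⟨U, hU'⟩ : ∃ U, U = ∑ i ∈ s, e i / p i := ⟨_, rfl⟩
  obtain ⟨C, hC⟩ : ∃ C, C = ∑ i ∈ s, d i / p i * e i := ⟨_, rfl⟩
  rw [← hU'] at hU
  have hlin (t : ℝ) (ht : D ≤ t) : t * U - C ≤ t := by
    refine le_trans (le_of_eq_of_le ?_ (Finset.sum_le_sum fun i hi =>
      mul_le_mul_of_nonneg_right (div_le_jobs ((hd i hi).trans ht)) (he i hi)))
      (h t (hD.trans_le ht))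
    rw [hU', hC, Finset.mul_sum, ← Finset.sum_sub_distrib]
    refine Finset.sum_congr rfl fun i _ => ?_
    ring
  have hlarge := hlin (max D ((C + 1) / (U - 1))) (le_max_left _ _)
  have := (div_le_iff₀ (sub_pos.2 hU)).1 (le_max_right D ((C + 1) / (U - 1)))
  linarith

/-- The bound for task sets with deadlines at most one. -/
theorem sum_approx_le {ι : Type*} (s : Finset ι) (e d p : ι → ℝ)
    (he : ∀ i ∈ s, 0 ≤ e i) (hd₀ : ∀ i ∈ s, 0 < d i) (hd₁ : ∀ i ∈ s, d i ≤ 1)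
    (hdp : ∀ i ∈ s, d i ≤ p i)
    (h : ∀ t, 0 < t → ∑ i ∈ s, jobs (d i) (p i) t * e i ≤ t) :
    ∑ i ∈ s, ((1 - d i) / p i + 1) * e i ≤ 14 / 9 := by
  have hmono (i) (hi : i ∈ s) : Monotone (jobs (d i) (p i)) :=
    jobs_monotone ((hd₀ i hi).trans_le (hdp i hi))
  have hdemand : ∑ i ∈ s, weightedDemand (jobs (d i) (p i)) * e i ≤ 3 / 2 := by
    rw [← weightedDemand_sum s _ e hmono, ← weightedDemand_id]
    refine weightedDemand_mono (fun x y hxy => Finset.sum_le_sum fun i hi =>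
      mul_le_mul_of_nonneg_right (hmono i hi hxy) (he i hi)) monotone_id fun t ht => ?_
    rcases ht.eq_or_lt with rfl | ht
    · refine (Finset.sum_eq_zero fun i hi => ?_).le
      rw [jobs, if_pos (hd₀ i hi), zero_mul]
    · exact h t ht
  have hutil := sum_div_le_one s e d p one_pos he hd₁ h
  calc ∑ i ∈ s, ((1 - d i) / p i + 1) * e i
      ≤ ∑ i ∈ s, (weightedDemand (jobs (d i) (p i)) + 1 / 18 / p i) * e i :=
        Finset.sum_le_sum fun i hi => mul_le_mul_of_nonneg_right
          (one_add_div_le_weightedDemand (hd₀ i hi) (hd₁ i hi) (hdp i hi)) (he i hi)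
    _ = ∑ i ∈ s, weightedDemand (jobs (d i) (p i)) * e i + 1 / 18 * ∑ i ∈ s, e i / p i := by
        rw [Finset.mul_sum, ← Finset.sum_add_distrib]
        refine Finset.sum_congr rfl fun i _ => ?_
        ring
    _ ≤ 14 / 9 := by linarith

/-- If a nonempty finite set of constrained-deadline tasks with positive real
parameters satisfies `dbf(τ,t) ≤ t` for all `t > 0`, and `D` is the largest relative
deadline, then `dbf*(τ, D) ≤ (14/9)·D`. -/
theorem stmt0 (n : ℕ) (hn : 0 < n) (e d p : ℕ → ℝ)
    (hpos : ∀ i ∈ Finset.Icc 1 n, 0 < e i ∧ 0 < d i ∧ 0 < p i)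
    (hcd : ∀ i ∈ Finset.Icc 1 n, d i ≤ p i)
    (hdbf : ∀ t : ℝ, 0 < t → ∑ i ∈ Finset.Icc 1 n, dbf (e i) (d i) (p i) t ≤ t)
    (D : ℝ) (hDmem : ∃ i ∈ Finset.Icc 1 n, d i = D)
    (hDmax : ∀ i ∈ Finset.Icc 1 n, d i ≤ D) :
    ∑ i ∈ Finset.Icc 1 n, dbfStar (e i) (d i) (p i) D ≤ 14 / 9 * D := by
  have hD : 0 < D := by
    obtain ⟨i, hi, rfl⟩ := hDmem
    exact (hpos i hi).2.1
  have hscaled := sum_approx_le (Finset.Icc 1 n) (fun i => e i / D) (fun i => d i / D)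
    (fun i => p i / D) (fun i hi => (div_pos (hpos i hi).1 hD).le)
    (fun i hi => div_pos (hpos i hi).2.1 hD) (fun i hi => (div_le_one hD).2 (hDmax i hi))
    (fun i hi => div_le_div_of_nonneg_right (hcd i hi) hD.le) fun t ht => by
      have := hdbf (D * t) (mul_pos hD ht)
      simp only [dbf_eq_jobs_mul] at this
      simp only [jobs_div_div _ _ _ hD, ← mul_div_assoc]
      rwa [← Finset.sum_div, div_le_iff₀' hD]
  rw [← div_le_iff₀ hD, Finset.sum_div]
  refine le_of_eq_of_le (Finset.sum_congr rfl fun i hi => ?_) hscaled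
  have := (hpos i hi).2.2.ne'
  rw [dbfStar, if_neg (hDmax i hi).not_gt]
  field_simp
end

section
/- For any positive integer n and positive reals x_1, x_2, …, x_n with ∑_{i=1}^n x_i = n², it holds that ∑_{i=1}^n i/x_i ≥ 4n/9. -/
open Finset

/-- Lower bound for the sum of the first `n` square roots by `∫₀ⁿ √t dt`. -/
theorem two_thirds_mul_sqrt_le_sum_sqrt (n : ℕ) :
    2 / 3 * ((n : ℝ) * √(n : ℝ)) ≤ ∑ i ∈ Finset.Icc 1 n, √(i : ℝ) := by
  induction n with
  | zero => simp
  | succ n ih =>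
    rw [Finset.sum_Icc_succ_top (by omega)]
    have ha := Real.sqrt_nonneg (n : ℝ)
    have hb := Real.sqrt_nonneg ((n + 1 : ℕ) : ℝ)
    have ha2 : √(n : ℝ) ^ 2 = n := Real.sq_sqrt (by positivity)
    have hb2 : √((n + 1 : ℕ) : ℝ) ^ 2 = (n : ℝ) + 1 := by
      rw [Real.sq_sqrt (by positivity)]; push_cast; ring
    have hcast : ((n + 1 : ℕ) : ℝ) = (n : ℝ) + 1 := by push_cast; ring
    generalize √((n + 1 : ℕ) : ℝ) = b at *
    generalize √(n : ℝ) = a at *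
    rw [hcast]
    have key : 0 ≤ (b - a) ^ 2 * (b + 2 * a) := by positivity
    have expand : (b - a) ^ 2 * (b + 2 * a) = b * b ^ 2 - 3 * a ^ 2 * b + 2 * (a ^ 2 * a) := by
      ring
    rw [expand, ha2, hb2] at key
    linarith

/-- If positive reals `x_1, …, x_n` sum to `n²`, then `∑ i/x_i ≥ 4n/9`. -/
theorem stmt2 (n : ℕ) (hn : 0 < n) (x : ℕ → ℝ)
    (hx : ∀ i ∈ Finset.Icc 1 n, 0 < x i)
    (hsum : ∑ i ∈ Finset.Icc 1 n, x i = (n : ℝ) ^ 2) :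
    ∑ i ∈ Finset.Icc 1 n, (i : ℝ) / x i ≥ 4 * n / 9 := by
  have hn' : (0 : ℝ) < n := by exact_mod_cast hn
  have hcs := Finset.sq_sum_div_le_sum_sq_div (Finset.Icc 1 n) (fun i : ℕ => √(i : ℝ)) hx
  have hsq : ∀ i : ℕ, √(i : ℝ) ^ 2 = i := fun i => Real.sq_sqrt (by positivity)
  simp only [hsq, hsum] at hcs
  refine le_trans ?_ hcs
  rw [le_div_iff₀ (by positivity)]
  calc 4 * (n : ℝ) / 9 * (n : ℝ) ^ 2 = (2 / 3 * ((n : ℝ) * √(n : ℝ))) ^ 2 := by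
        rw [mul_pow, mul_pow, hsq]; ring
    _ ≤ _ := pow_le_pow_left₀ (by positivity) (two_thirds_mul_sqrt_le_sum_sqrt n) 2
end

section
/- Let n be a positive integer, δ a positive real, and for 1 ≤ i ≤ n let τ_i = (δ, i·δ, p_i) with p_i a positive real. Suppose there is a permutation π of {1,…,n} with d_{π(i)} + p_{π(i)} = n·δ + i·δ for all i (τ is aligned, where d_i = i·δ). Then ∑_{j=1}^n (d_j + p_j − n·δ)/p_j ≥ 4n/9. -/
open Finset

/-- A finite set mapped into itself by a permutation can be reindexed along that permutation. -/
theorem sum_comp_perm_of_mapsTo {α M : Type*} [AddCommMonoid M] (s : Finset α)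
    (σ : Equiv.Perm α) (hσ : ∀ i ∈ s, σ i ∈ s) (f : α → M) :
    ∑ i ∈ s, f (σ i) = ∑ i ∈ s, f i := by
  have h : s.map σ.toEmbedding = s := by
    refine Finset.eq_of_subset_of_card_le (fun x hx => ?_) (by simp)
    obtain ⟨i, hi, rfl⟩ := Finset.mem_map.1 hx
    exact hσ i hi
  conv_rhs => rw [← h, Finset.sum_map]
  rfl

/-- The sum of the first `n` square roots is at least `(2 / 3) * n ^ (3 / 2)`. -/
theorem two_thirds_mul_le_sum_sqrt (n : ℕ) :
    2 / 3 * (n * √(n : ℝ)) ≤ ∑ i ∈ Finset.Icc 1 n, √(i : ℝ) := by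
  induction n with
  | zero => simp
  | succ n ih =>
    rw [Finset.sum_Icc_succ_top (by omega)]
    have ha := Real.sqrt_nonneg (n : ℝ)
    have hb := Real.sqrt_nonneg ((n + 1 : ℕ) : ℝ)
    have ha2 := Real.sq_sqrt (Nat.cast_nonneg (α := ℝ) n)
    have hb2 := Real.sq_sqrt (Nat.cast_nonneg (α := ℝ) (n + 1))
    set a := √(n : ℝ)
    set b := √((n + 1 : ℕ) : ℝ)
    have hab : b ^ 2 = a ^ 2 + 1 := by rw [ha2, hb2]; push_cast; ring
    have key : 0 ≤ (b - a) ^ 2 * (b + 2 * a) := by positivity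
    rw [← ha2] at ih
    rw [← hb2]
    have hexp : (b - a) ^ 2 * (b + 2 * a) = 3 * b * (b ^ 2 - a ^ 2) - 2 * b ^ 3 + 2 * a ^ 3 := by
      ring
    rw [hexp, hab] at key
    linarith

/-- A tangent-line lower bound for `x / z`. -/
theorem tangent_le_div {x z m : ℝ} (hx : 0 ≤ x) (hz : 0 < z) (hm : 0 < m) :
    4 / 3 * (√x / √m) - 4 / 9 * (z / m) ≤ x / z := by
  have hs := Real.sqrt_pos.2 hm
  have hx2 := Real.sq_sqrt hx
  have hm2 := Real.sq_sqrt hm.le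
  have h : x / z - (4 / 3 * (√x / √m) - 4 / 9 * (z / m))
      = (√x - 2 / 3 * (z / √m)) ^ 2 / z := by
    conv_lhs => rw [← hx2, ← hm2, Real.sqrt_sq hs.le, Real.sqrt_sq (Real.sqrt_nonneg x)]
    field_simp
    ring
  have : 0 ≤ (√x - 2 / 3 * (z / √m)) ^ 2 / z := by positivity
  linarith

/-- For tasks `τ_i = (δ, i·δ, p_i)` (`1 ≤ i ≤ n`, positive real parameters)
that are aligned, `∑_{j=1}^n (d_j + p_j − n·δ)/p_j ≥ 4n/9`. -/
theorem stmt5 (n : ℕ) (hn : 0 < n) (δ : ℝ) (hδ : 0 < δ)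
    (p : ℕ → ℝ) (hp : ∀ i ∈ Finset.Icc 1 n, 0 < p i)
    (π : Equiv.Perm ℕ) (hπ : ∀ i ∈ Finset.Icc 1 n, π i ∈ Finset.Icc 1 n)
    (halign : ∀ i ∈ Finset.Icc 1 n, (π i : ℝ) * δ + p (π i) = (n : ℝ) * δ + (i : ℝ) * δ) :
    ∑ j ∈ Finset.Icc 1 n, ((j : ℝ) * δ + p j - (n : ℝ) * δ) / p j ≥ 4 * n / 9 := by
  have hm : (0 : ℝ) < n := by exact_mod_cast hn
  have hs := Real.sqrt_pos.2 hm
  rw [← sum_comp_perm_of_mapsTo _ π hπ]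
  have hterm : ∀ i ∈ Finset.Icc 1 n,
      4 / 3 * (√(i : ℝ) / √(n : ℝ)) - 4 / 9 * (((n : ℝ) + i - (π i : ℕ)) / n)
        ≤ ((π i : ℝ) * δ + p (π i) - (n : ℝ) * δ) / p (π i) := by
    intro i hi
    have hpi : p (π i) = δ * ((n : ℝ) + i - (π i : ℕ)) := by linarith [halign i hi]
    have hz : 0 < (n : ℝ) + i - (π i : ℕ) :=
      pos_of_mul_pos_right (hpi ▸ hp _ (hπ i hi)) hδ.le
    have hnum : (π i : ℝ) * δ + p (π i) - (n : ℝ) * δ = δ * i := by linarith [halign i hi]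
    rw [hnum, hpi, mul_div_mul_left _ _ hδ.ne']
    exact tangent_le_div (Nat.cast_nonneg i) hz hm
  refine le_trans ?_ (Finset.sum_le_sum hterm)
  rw [Finset.sum_sub_distrib, ← Finset.mul_sum, ← Finset.mul_sum, ← Finset.sum_div,
    ← Finset.sum_div, Finset.sum_sub_distrib, Finset.sum_add_distrib,
    sum_comp_perm_of_mapsTo _ π hπ (fun i => (i : ℝ))]
  have hsqrt : 2 / 3 * (n : ℝ) ≤ (∑ i ∈ Finset.Icc 1 n, √(i : ℝ)) / √(n : ℝ) := by
    rw [le_div_iff₀ hs, mul_assoc]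
    exact two_thirds_mul_le_sum_sqrt n
  have hz : ((∑ _i ∈ Finset.Icc 1 n, (n : ℝ)) + ∑ i ∈ Finset.Icc 1 n, (i : ℝ)
      - ∑ i ∈ Finset.Icc 1 n, (i : ℝ)) / n = n := by
    simp
  rw [hz]
  linarith
end

section
/- Let τ = {τ_i=(e_i,d_i,p_i): 1 ≤ i ≤ n} be constrained-deadline tasks with positive real parameters such that d_1 ≤ d_2 ≤ … ≤ d_n, dbf(τ,t) ≤ t for all t > 0, and d_i + p_i > d_n for all 1 ≤ i ≤ n−1. Then for any ε > 0 there exists a task set τ' = {τ'_i=(e'_i,d'_i,p'_i): 1 ≤ i ≤ n} all of whose parameters are positive rationals, such that: each τ'_i is constrained-deadline; d'_1 ≤ d'_2 ≤ … ≤ d'_n; d'_i + p'_i > d'_n for all 1 ≤ i ≤ n−1; dbf(τ',t) ≤ t for all t > 0; and |e'_i − e_i| < ε, |d'_i − d_i| < ε, |p'_i − p_i| < ε for all 1 ≤ i ≤ n. -/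
open Finset

/-- The demand bound function is antitone in the deadline and the period, and monotone in the
execution time. -/
theorem dbf_le_dbf {e d p e' d' p' : ℝ} (t : ℝ) (he' : 0 ≤ e') (hp : 0 < p)
    (he : e' ≤ e) (hd : d ≤ d') (hpp : p ≤ p') : dbf e' d' p' t ≤ dbf e d p t := by
  unfold dbf
  split_ifs with h' h h
  · exact le_rfl
  · have h0 : (0 : ℝ) ≤ (⌊(t - d) / p⌋ : ℝ) := by
      exact_mod_cast Int.floor_nonneg.2 (div_nonneg (by linarith) hp.le)
    exact mul_nonneg (by linarith) (he'.trans he)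
  · linarith
  · have hle : (t - d') / p' ≤ (t - d) / p :=
      div_le_div₀ (by linarith) (by linarith) hp hpp
    have hfl : (⌊(t - d') / p'⌋ : ℝ) ≤ (⌊(t - d) / p⌋ : ℝ) := by
      exact_mod_cast Int.floor_mono hle
    have h0 : (0 : ℝ) ≤ (⌊(t - d) / p⌋ : ℝ) := by
      exact_mod_cast Int.floor_nonneg.2 (div_nonneg (by linarith) hp.le)
    exact mul_le_mul (by linarith) he he' (by linarith)

/-- The least multiple of `1 / (N + 1)` that is at least `x`. -/
noncomputable def ratCeil (N : ℕ) (x : ℝ) : ℚ := (⌈x * (N + 1)⌉ : ℚ) / (N + 1)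

theorem ratCeil_mono (N : ℕ) : Monotone (ratCeil N) := by
  intro x y h
  unfold ratCeil
  gcongr

theorem le_ratCeil (N : ℕ) (x : ℝ) : x ≤ ratCeil N x := by
  have hN : (0 : ℝ) < N + 1 := by positivity
  unfold ratCeil
  push_cast
  rw [le_div_iff₀ hN]
  exact Int.le_ceil _

theorem ratCeil_lt (N : ℕ) (x : ℝ) : (ratCeil N x : ℝ) < x + 1 / ((N : ℝ) + 1) := by
  have hN : (0 : ℝ) < N + 1 := by positivity
  unfold ratCeil
  push_cast
  rw [div_lt_iff₀ hN, add_mul, one_div_mul_cancel hN.ne']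
  exact Int.ceil_lt_add_one _

/-- Any feasible set of constrained-deadline tasks with positive real parameters
(sorted deadlines, `dbf(τ,t) ≤ t`, `d_i + p_i > d_n` for `i < n`) can be perturbed by less than
any `ε > 0` into one with positive rational parameters satisfying the same constraints. -/
theorem stmt6 (n : ℕ) (hn : 0 < n) (e d p : ℕ → ℝ)
    (hpos : ∀ i ∈ Finset.Icc 1 n, 0 < e i ∧ 0 < d i ∧ 0 < p i)
    (hcd : ∀ i ∈ Finset.Icc 1 n, d i ≤ p i)
    (hmono : ∀ i ∈ Finset.Icc 1 n, ∀ j ∈ Finset.Icc 1 n, i ≤ j → d i ≤ d j)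
    (hdbf : ∀ t : ℝ, 0 < t → ∑ i ∈ Finset.Icc 1 n, dbf (e i) (d i) (p i) t ≤ t)
    (hdp : ∀ i ∈ Finset.Icc 1 (n - 1), d i + p i > d n)
    (ε : ℝ) (hε : 0 < ε) :
    ∃ e' d' p' : ℕ → ℚ,
      (∀ i ∈ Finset.Icc 1 n, 0 < e' i ∧ 0 < d' i ∧ 0 < p' i) ∧
      (∀ i ∈ Finset.Icc 1 n, d' i ≤ p' i) ∧
      (∀ i ∈ Finset.Icc 1 n, ∀ j ∈ Finset.Icc 1 n, i ≤ j → d' i ≤ d' j) ∧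
      (∀ i ∈ Finset.Icc 1 (n - 1), d' i + p' i > d' n) ∧
      (∀ t : ℝ, 0 < t →
        ∑ i ∈ Finset.Icc 1 n, dbf ((e' i : ℝ)) ((d' i : ℝ)) ((p' i : ℝ)) t ≤ t) ∧
      (∀ i ∈ Finset.Icc 1 n,
        |(e' i : ℝ) - e i| < ε ∧ |(d' i : ℝ) - d i| < ε ∧ |(p' i : ℝ) - p i| < ε) := by
  have hlim := tendsto_one_div_add_atTop_nhds_zero_nat (𝕜 := ℝ)
  have hgap : ∀ᶠ N : ℕ in Filter.atTop, ∀ i ∈ Finset.Icc 1 (n - 1),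
      1 / ((N : ℝ) + 1) < d i + p i - d n :=
    (Filter.eventually_all_finset _).2 fun i hi =>
      hlim.eventually_lt_const (sub_pos.2 (hdp i hi))
  obtain ⟨N, hNgap, hNε⟩ := (hgap.and (hlim.eventually_lt_const hε)).exists
  have hrat : ∀ i, ∃ q : ℚ, i ∈ Finset.Icc 1 n → 0 < (q : ℝ) ∧ e i - ε < q ∧ (q : ℝ) < e i := by
    intro i
    by_cases hi : i ∈ Finset.Icc 1 n
    · obtain ⟨q, hq, hq'⟩ := exists_rat_btwn
        (max_lt (hpos i hi).1 (sub_lt_self (e i) hε))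
      exact ⟨q, fun _ => ⟨(le_max_left _ _).trans_lt hq, (le_max_right _ _).trans_lt hq, hq'⟩⟩
    · exact ⟨0, fun h => absurd h hi⟩
  choose e' he' using hrat
  have habs : ∀ x : ℝ, |(ratCeil N x : ℝ) - x| < ε := fun x => by
    rw [abs_lt]
    constructor <;> linarith [le_ratCeil N x, ratCeil_lt N x]
  have hceil_pos : ∀ x : ℝ, 0 < x → 0 < ratCeil N x := fun x hx => by
    exact_mod_cast hx.trans_le (le_ratCeil N x)
  refine ⟨e', fun i => ratCeil N (d i), fun i => ratCeil N (p i), fun i hi => ?_,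
    fun i hi => ratCeil_mono N (hcd i hi),
    fun i hi j hj hij => ratCeil_mono N (hmono i hi j hj hij), fun i hi => ?_, fun t ht => ?_,
    fun i hi => ⟨?_, habs _, habs _⟩⟩
  · exact ⟨by exact_mod_cast (he' i hi).1, hceil_pos _ (hpos i hi).2.1, hceil_pos _ (hpos i hi).2.2⟩
  · have h : (ratCeil N (d n) : ℝ) < ratCeil N (d i) + ratCeil N (p i) := by
      linarith [ratCeil_lt N (d n), hNgap i hi, le_ratCeil N (d i), le_ratCeil N (p i)]
    exact_mod_cast h
  · refine (Finset.sum_le_sum fun i hi => ?_).trans (hdbf t ht)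
    exact dbf_le_dbf t (he' i hi).1.le (hpos i hi).2.2 (he' i hi).2.2.le
      (le_ratCeil N _) (le_ratCeil N _)
  · obtain ⟨-, h₁, h₂⟩ := he' i hi
    rw [abs_lt]
    constructor <;> linarith
end

section
/- Let τ = {τ_i=(e_i,d_i,p_i): 1 ≤ i ≤ n} be constrained-deadline tasks with positive rational parameters satisfying: d_1 ≤ … ≤ d_n; dbf(τ,t) ≤ t for all t > 0; d_i + p_i > d_n for all 1 ≤ i ≤ n−1. With d_0 := 0, suppose M(τ) := #{i : 1 ≤ i ≤ n, d_i ≠ e_i + d_{i−1}} > 0. Then there exists a set τ' = {τ'_i=(e'_i,d'_i,p'_i): 1 ≤ i ≤ n} of constrained-deadline tasks with positive rational parameters satisfying the same three constraints, such that M(τ') < M(τ) and dbf*(τ', d'_n)/d'_n ≥ dbf*(τ, d_n)/d_n. -/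
open Finset

lemma dbf_nonneg {e d p t : ℝ} (he : 0 ≤ e) (hp : 0 < p) : 0 ≤ dbf e d p t := by
  unfold dbf
  split_ifs with h
  · exact le_rfl
  · have : (0 : ℝ) ≤ ⌊(t - d) / p⌋ := by
      exact_mod_cast Int.floor_nonneg.2 (div_nonneg (by linarith) hp.le)
    positivity

lemma le_dbf {e d p t : ℝ} (he : 0 ≤ e) (hp : 0 < p) (h : d ≤ t) : e ≤ dbf e d p t := by
  have : (0 : ℝ) ≤ ⌊(t - d) / p⌋ := by
    exact_mod_cast Int.floor_nonneg.2 (div_nonneg (by linarith) hp.le)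
  rw [dbf, if_neg h.not_gt]
  nlinarith

lemma dbf_eq_ite_of_lt {e d p t : ℝ} (hp : 0 < p) (h : t < d + p) :
    dbf e d p t = if d ≤ t then e else 0 := by
  by_cases hd : d ≤ t
  · have : ⌊(t - d) / p⌋ = 0 := by
      rw [Int.floor_eq_zero_iff, Set.mem_Ico, div_lt_one hp]
      exact ⟨div_nonneg (by linarith) hp.le, by linarith⟩
    rw [dbf, if_neg hd.not_gt, if_pos hd, this]
    simp
  · rw [dbf, if_pos (not_le.1 hd), if_neg hd]

/-- Past the deadline `d`, moving the deadline to the earlier date `s` while keeping the second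
deadline `d + p` does not increase the demand. -/
lemma dbf_advance_le {e d p s t : ℝ} (he : 0 ≤ e) (hp : 0 < p) (hs : s ≤ d) (h : d ≤ t) :
    dbf e s (d + p - s) t ≤ dbf e d p t := by
  have hm : 0 ≤ ⌊(t - d) / p⌋ := Int.floor_nonneg.2 (div_nonneg (by linarith) hp.le)
  have hmR : (0 : ℝ) ≤ ⌊(t - d) / p⌋ := by exact_mod_cast hm
  have hfl : ⌊(t - s) / (d + p - s)⌋ ≤ ⌊(t - d) / p⌋ := by
    rw [← Int.lt_add_one_iff, Int.floor_lt, div_lt_iff₀ (by linarith)]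
    push_cast
    have := (div_lt_iff₀ hp).1 (Int.lt_floor_add_one ((t - d) / p))
    nlinarith [mul_nonneg hmR (sub_nonneg.2 hs)]
  have hflR : (⌊(t - s) / (d + p - s)⌋ : ℝ) ≤ ⌊(t - d) / p⌋ := by exact_mod_cast hfl
  rw [dbf, dbf, if_neg (by linarith), if_neg h.not_gt]
  gcongr

lemma sum_utilization_le_one {ι : Type*} (I : Finset ι) (e d p : ι → ℝ) (D : ℝ)
    (he : ∀ i ∈ I, 0 ≤ e i) (hd : ∀ i ∈ I, d i ≤ D)
    (h : ∀ t : ℝ, 0 < t → ∑ i ∈ I, dbf (e i) (d i) (p i) t ≤ t) :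
    ∑ i ∈ I, e i / p i ≤ 1 := by
  by_contra! hU
  set U := ∑ i ∈ I, e i / p i with hUdef
  set C := ∑ i ∈ I, e i * d i / p i with hC
  have key : ∀ t : ℝ, 0 < t → D ≤ t → U * t - C ≤ t := by
    intro t ht hDt
    refine le_trans ?_ (h t ht)
    rw [hUdef, hC, Finset.sum_mul, ← Finset.sum_sub_distrib]
    refine Finset.sum_le_sum fun i hi => ?_
    rw [dbf, if_neg (by linarith [hd i hi])]
    have := mul_le_mul_of_nonneg_right (Int.lt_floor_add_one ((t - d i) / p i)).le (he i hi)
    calc e i / p i * t - e i * d i / p i = (t - d i) / p i * e i := by ring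
      _ ≤ _ := this
  have hU' : 0 < U - 1 := by linarith
  have h1 := key (max (max 1 D) ((C + 1) / (U - 1)))
    (by have := le_max_left (1 : ℝ) D
        have := le_max_left (max 1 D) ((C + 1) / (U - 1))
        linarith)
    ((le_max_right _ _).trans (le_max_left _ _))
  have h2 := (div_le_iff₀ hU').1 (le_max_right (max 1 D) ((C + 1) / (U - 1)))
  linarith

lemma sum_ite_prefix_le {n : ℕ} {e : ℕ → ℝ} (he : ∀ i ∈ Icc 1 n, 0 ≤ e i) {t : ℝ} (ht : 0 ≤ t) :
    ∑ i ∈ Icc 1 n, (if ∑ j ∈ Icc 1 i, e j ≤ t then e i else 0) ≤ t := by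
  rw [← Finset.sum_filter]
  rcases ((Icc 1 n).filter fun i => ∑ j ∈ Icc 1 i, e j ≤ t).eq_empty_or_nonempty with h | h
  · simpa [h] using ht
  · obtain ⟨hm, hmt⟩ := Finset.mem_filter.1 (Finset.max'_mem _ h)
    refine le_trans (Finset.sum_le_sum_of_subset_of_nonneg (fun i hi => ?_) fun i hi _ => ?_) hmt
    · exact Finset.mem_Icc.2
        ⟨(Finset.mem_Icc.1 (Finset.mem_filter.1 hi).1).1, Finset.le_max' _ i hi⟩
    · rw [Finset.mem_Icc] at hi hm
      exact he i (Finset.mem_Icc.2 ⟨hi.1, hi.2.trans hm.2⟩)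

lemma prefix_sum_le_deadline {n : ℕ} {e d p : ℕ → ℝ}
    (he : ∀ i ∈ Icc 1 n, 0 ≤ e i) (hp : ∀ i ∈ Icc 1 n, 0 < p i)
    (hmono : ∀ i ∈ Icc 1 n, ∀ j ∈ Icc 1 n, i ≤ j → d i ≤ d j) {k : ℕ} (hk : k ∈ Icc 1 n)
    (h : ∑ i ∈ Icc 1 n, dbf (e i) (d i) (p i) (d k) ≤ d k) :
    ∑ j ∈ Icc 1 k, e j ≤ d k := by
  have hsub : Icc 1 k ⊆ Icc 1 n := Finset.Icc_subset_Icc_right (Finset.mem_Icc.1 hk).2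
  calc ∑ j ∈ Icc 1 k, e j ≤ ∑ j ∈ Icc 1 k, dbf (e j) (d j) (p j) (d k) :=
        Finset.sum_le_sum fun j hj => le_dbf (he j (hsub hj)) (hp j (hsub hj))
          (hmono j (hsub hj) k hk (Finset.mem_Icc.1 hj).2)
    _ ≤ ∑ j ∈ Icc 1 n, dbf (e j) (d j) (p j) (d k) :=
        Finset.sum_le_sum_of_subset_of_nonneg hsub fun j hj _ => dbf_nonneg (he j hj) (hp j hj)
    _ ≤ d k := h

/-- Replacing the deadlines `d i` by earlier ones `s i`, and the last deadline `D` by the total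
execution time `E`, while keeping `d i + p i`, does not decrease the normalised approximate
demand. -/
lemma sum_dbfStar_div_le {ι : Type*} (I : Finset ι) (e d p s : ι → ℝ) {E D : ℝ}
    (hE : E = ∑ i ∈ I, e i) (hE0 : 0 < E) (hED : E ≤ D)
    (he : ∀ i ∈ I, 0 ≤ e i) (hp : ∀ i ∈ I, 0 < p i) (hsE : ∀ i ∈ I, s i ≤ E)
    (hsd : ∀ i ∈ I, s i ≤ d i) (hdD : ∀ i ∈ I, d i ≤ D) (hdp : ∀ i ∈ I, D ≤ d i + p i)
    (hU : ∑ i ∈ I, e i / p i ≤ 1) :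
    (∑ i ∈ I, dbfStar (e i) (d i) (p i) D) / D ≤
      (∑ i ∈ I, dbfStar (e i) (s i) (d i + p i - s i) E) / E := by
  set A := ∑ i ∈ I, (E - s i) / (d i + p i - s i) * e i with hA
  set B := ∑ i ∈ I, (D - d i) / p i * e i with hB
  have hold : ∑ i ∈ I, dbfStar (e i) (d i) (p i) D = B + E := by
    rw [hE, hB, ← Finset.sum_add_distrib]
    refine Finset.sum_congr rfl fun i hi => ?_
    rw [dbfStar, if_neg (hdD i hi).not_gt]
    ring
  have hnew : ∑ i ∈ I, dbfStar (e i) (s i) (d i + p i - s i) E = A + E := by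
    nth_rewrite 2 [hE]
    rw [hA, ← Finset.sum_add_distrib]
    refine Finset.sum_congr rfl fun i hi => ?_
    rw [dbfStar, if_neg (hsE i hi).not_gt]
    ring
  have hA0 : 0 ≤ A := Finset.sum_nonneg fun i hi => by
    have := he i hi
    have := hsE i hi
    have := hsd i hi
    have := hp i hi
    exact mul_nonneg (div_nonneg (by linarith) (by linarith)) (he i hi)
  have hBA : B ≤ A + (D - E) * ∑ i ∈ I, e i / p i := by
    rw [hA, hB, Finset.mul_sum, ← Finset.sum_add_distrib]
    refine Finset.sum_le_sum fun i hi => ?_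
    have h1 := hsE i hi
    have h2 := hsd i hi
    have h3 := hp i hi
    have h4 := hdp i hi
    have h5 : (D - d i) / p i ≤ (E - s i) / (d i + p i - s i) + (D - E) / p i := by
      have hq : 0 < d i + p i - s i := by linarith
      have h6 : (E - d i) / p i ≤ (E - s i) / (d i + p i - s i) := by
        rw [div_le_div_iff₀ h3 hq]
        nlinarith [mul_nonneg (sub_nonneg.2 h2) (by linarith : 0 ≤ d i + p i - E)]
      calc (D - d i) / p i = (E - d i) / p i + (D - E) / p i := by ring
        _ ≤ _ := by linarith
    calc (D - d i) / p i * e i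
        ≤ ((E - s i) / (d i + p i - s i) + (D - E) / p i) * e i :=
          mul_le_mul_of_nonneg_right h5 (he i hi)
      _ = _ := by ring
  have hBA' : B ≤ A + (D - E) := by nlinarith
  rw [hold, hnew, div_le_div_iff₀ (by linarith) hE0]
  nlinarith [mul_le_mul_of_nonneg_right hBA' hE0.le, mul_nonneg hA0 (sub_nonneg.2 hED)]

/-- Given a feasible set of constrained-deadline tasks with positive rational
parameters (sorted deadlines, `dbf(τ,t) ≤ t`, `d_i + p_i > d_n` for `i ≤ n−1`) with
`M(τ) = #{i : d_i ≠ e_i + d_{i−1}} > 0` (where `d_0 := 0`), there is a task set `τ'` of the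
same kind with `M(τ') < M(τ)` and `dbf*(τ', d'_n)/d'_n ≥ dbf*(τ, d_n)/d_n`. -/
theorem stmt7 (n : ℕ) (hn : 0 < n) (e d p : ℕ → ℚ) (hd0 : d 0 = 0)
    (hpos : ∀ i ∈ Finset.Icc 1 n, 0 < e i ∧ 0 < d i ∧ 0 < p i)
    (hcd : ∀ i ∈ Finset.Icc 1 n, d i ≤ p i)
    (hmono : ∀ i ∈ Finset.Icc 1 n, ∀ j ∈ Finset.Icc 1 n, i ≤ j → d i ≤ d j)
    (hdbf : ∀ t : ℝ, 0 < t →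
      ∑ i ∈ Finset.Icc 1 n, dbf ((e i : ℝ)) ((d i : ℝ)) ((p i : ℝ)) t ≤ t)
    (hdp : ∀ i ∈ Finset.Icc 1 (n - 1), d i + p i > d n)
    (hM : 0 < ((Finset.Icc 1 n).filter (fun i => d i ≠ e i + d (i - 1))).card) :
    ∃ e' d' p' : ℕ → ℚ, d' 0 = 0 ∧
      (∀ i ∈ Finset.Icc 1 n, 0 < e' i ∧ 0 < d' i ∧ 0 < p' i) ∧
      (∀ i ∈ Finset.Icc 1 n, d' i ≤ p' i) ∧
      (∀ i ∈ Finset.Icc 1 n, ∀ j ∈ Finset.Icc 1 n, i ≤ j → d' i ≤ d' j) ∧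
      (∀ t : ℝ, 0 < t →
        ∑ i ∈ Finset.Icc 1 n, dbf ((e' i : ℝ)) ((d' i : ℝ)) ((p' i : ℝ)) t ≤ t) ∧
      (∀ i ∈ Finset.Icc 1 (n - 1), d' i + p' i > d' n) ∧
      ((Finset.Icc 1 n).filter (fun i => d' i ≠ e' i + d' (i - 1))).card <
        ((Finset.Icc 1 n).filter (fun i => d i ≠ e i + d (i - 1))).card ∧
      (∑ i ∈ Finset.Icc 1 n, dbfStar ((e' i : ℝ)) ((d' i : ℝ)) ((p' i : ℝ)) ((d' n : ℝ))) /
          (d' n : ℝ) ≥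
        (∑ i ∈ Finset.Icc 1 n, dbfStar ((e i : ℝ)) ((d i : ℝ)) ((p i : ℝ)) ((d n : ℝ))) /
          (d n : ℝ) := by
  have he : ∀ i ∈ Icc 1 n, (0 : ℝ) < e i := fun i hi => by exact_mod_cast (hpos i hi).1
  have hp : ∀ i ∈ Icc 1 n, (0 : ℝ) < p i := fun i hi => by exact_mod_cast (hpos i hi).2.2
  have hmonoR : ∀ i ∈ Icc 1 n, ∀ j ∈ Icc 1 n, i ≤ j → (d i : ℝ) ≤ d j :=
    fun i hi j hj h => by exact_mod_cast hmono i hi j hj h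
  have hnn : n ∈ Icc 1 n := Finset.mem_Icc.2 ⟨hn, le_rfl⟩
  have hdn : ∀ i ∈ Icc 1 n, d i ≤ d n := fun i hi => hmono i hi n hnn (Finset.mem_Icc.1 hi).2
  have hq : ∀ i ∈ Icc 1 n, d n < d i + p i := by
    intro i hi
    obtain ⟨h1, h2⟩ := Finset.mem_Icc.1 hi
    rcases h2.eq_or_lt with rfl | h
    · linarith [(hpos i hi).2.2]
    · exact hdp i (Finset.mem_Icc.2 ⟨h1, by omega⟩)
  set s : ℕ → ℚ := fun k => ∑ j ∈ Icc 1 k, e j with hs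
  have hsR : ∀ k, (s k : ℝ) = ∑ j ∈ Icc 1 k, (e j : ℝ) := fun k => by simp [hs]
  have hs_mono : ∀ i j, i ≤ j → j ≤ n → s i ≤ s j := fun i j hij hj =>
    Finset.sum_le_sum_of_subset_of_nonneg (Finset.Icc_subset_Icc_right hij) fun k hk _ =>
      (hpos k (Finset.Icc_subset_Icc_right hj hk)).1.le
  have hs_pos : ∀ i ∈ Icc 1 n, 0 < s i := fun i hi => by
    obtain ⟨h1, h2⟩ := Finset.mem_Icc.1 hi
    exact Finset.sum_pos (fun k hk => (hpos k (Finset.Icc_subset_Icc_right h2 hk)).1)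
      ⟨1, Finset.mem_Icc.2 ⟨le_rfl, h1⟩⟩
  have hsd : ∀ i ∈ Icc 1 n, s i ≤ d i := fun i hi => by
    have := prefix_sum_le_deadline (fun j hj => (he j hj).le) hp hmonoR hi
      (hdbf _ (by exact_mod_cast (hpos i hi).2.1))
    rw [← hsR] at this
    exact_mod_cast this
  have hs_succ : ∀ i ∈ Icc 1 n, s i = e i + s (i - 1) := fun i hi => by
    obtain ⟨k, rfl⟩ := Nat.exists_eq_add_of_le' (Finset.mem_Icc.1 hi).1
    simp only [hs, Nat.add_sub_cancel]
    rw [Finset.sum_Icc_succ_top (by omega), add_comm]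
  refine ⟨e, s, fun i => d i + p i - s i, by simp [hs], fun i hi => ⟨(hpos i hi).1, hs_pos i hi, ?_⟩,
    fun i hi => ?_, fun i hi j hj hij => hs_mono i j hij (Finset.mem_Icc.1 hj).2, fun t ht => ?_,
    fun i hi => ?_, ?_, ?_⟩
  · linarith [hsd i hi, (hpos i hi).2.2]
  · linarith [hsd i hi, hcd i hi]
  · push_cast
    rcases le_or_gt (d n : ℝ) t with h | h
    · refine (Finset.sum_le_sum fun i hi => ?_).trans (hdbf t ht)
      exact dbf_advance_le (he i hi).le (hp i hi) (by exact_mod_cast hsd i hi)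
        ((hmonoR i hi n hnn (Finset.mem_Icc.1 hi).2).trans h)
    · refine le_trans (le_of_eq (Finset.sum_congr rfl fun i hi => ?_))
        (sum_ite_prefix_le (fun i hi => (he i hi).le) ht.le)
      have h1 : (d n : ℝ) < d i + p i := by exact_mod_cast hq i hi
      have h2 : (s i : ℝ) ≤ d i := by exact_mod_cast hsd i hi
      rw [dbf_eq_ite_of_lt (by linarith [hp i hi]) (by linarith), hsR]
  · have hi' : i ∈ Icc 1 n := Finset.Icc_subset_Icc_right (Nat.sub_le n 1) hi
    linarith [hq i hi', hsd n hnn]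
  · rwa [Finset.filter_false_of_mem fun i hi => not_not.2 (hs_succ i hi), Finset.card_empty]
  · push_cast
    refine sum_dbfStar_div_le (Icc 1 n) (fun i => (e i : ℝ)) (fun i => (d i : ℝ))
      (fun i => (p i : ℝ)) (fun i => (s i : ℝ)) (hsR n) (by exact_mod_cast hs_pos n hnn)
      (by exact_mod_cast hsd n hnn) (fun i hi => (he i hi).le) hp
      (fun i hi => ?_) (fun i hi => by exact_mod_cast hsd i hi)
      (fun i hi => by exact_mod_cast hdn i hi) (fun i hi => by exact_mod_cast (hq i hi).le)
      (sum_utilization_le_one _ _ _ _ (d n : ℝ) (fun i hi => (he i hi).le)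
        (fun i hi => by exact_mod_cast hdn i hi) hdbf)
    exact_mod_cast hs_mono i n (Finset.mem_Icc.1 hi).2 le_rfl
end

section
/- Let τ = {τ_i=(e_i,d_i,p_i): 1 ≤ i ≤ n} be constrained-deadline tasks with positive real parameters and d_1 ≤ … ≤ d_n. For each i define k_i := ⌊(d_n − d_i)/p_i⌋, e'_i := (k_i+1)·e_i, p'_i := (k_i+1)·p_i, d'_i := k_i·p_i + d_i, and let τ' = {τ'_i=(e'_i,d'_i,p'_i): 1 ≤ i ≤ n}. Then: (i) dbf*(τ', d_n) = dbf*(τ, d_n); (ii) dbf(τ', t) ≤ dbf(τ, t) for all t > 0; (iii) d'_i + p'_i > d_n for all 1 ≤ i ≤ n; (iv) d'_n = d_n; and (v) p'_i − d'_i = p_i − d_i for all i, so each τ'_i is constrained-deadline. -/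
open Finset

/-- Merging `k + 1` consecutive jobs of a task into one preserves the approximate demand at any
time no earlier than the merged deadline. -/
theorem dbfStar_merge {e d p t k : ℝ} (hp : 0 < p) (hk : 0 ≤ k) (ht : k * p + d ≤ t) :
    dbfStar ((k + 1) * e) (k * p + d) ((k + 1) * p) t = dbfStar e d p t := by
  have hkp : 0 ≤ k * p := by positivity
  have hk1 : k + 1 ≠ 0 := by positivity
  rw [dbfStar, dbfStar, if_neg (by linarith), if_neg (by linarith)]
  field_simp
  ring

/-- Merging `k + 1` consecutive jobs of a task into one, due at the deadline of the last of them,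
does not increase the demand. -/
theorem dbf_merge_le {e d p : ℝ} {k : ℤ} (he : 0 ≤ e) (hp : 0 < p) (hk : 0 ≤ k) (t : ℝ) :
    dbf ((k + 1) * e) (k * p + d) ((k + 1) * p) t ≤ dbf e d p t := by
  have hk' : (0 : ℝ) ≤ k := by exact_mod_cast hk
  have hkp : 0 ≤ k * p := by positivity
  unfold dbf
  split_ifs with h₁ h₂ h₂
  · exact le_rfl
  · have hfloor : (0 : ℝ) ≤ ⌊(t - d) / p⌋ := by
      exact_mod_cast Int.floor_nonneg.2 (div_nonneg (by linarith) hp.le)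
    positivity
  · linarith
  · rw [← mul_assoc]
    refine mul_le_mul_of_nonneg_right ?_ he
    set m := ⌊(t - (k * p + d)) / ((k + 1) * p)⌋
    have hm_le : (m : ℝ) * ((k + 1) * p) ≤ t - (k * p + d) :=
      (le_div_iff₀ (by positivity)).1 (Int.floor_le _)
    have hle : m * (k + 1) + k ≤ ⌊(t - d) / p⌋ := by
      rw [Int.le_floor, le_div_iff₀ hp]
      push_cast
      linarith
    have hcast : (m : ℝ) * (k + 1) + k ≤ ⌊(t - d) / p⌋ := by exact_mod_cast hle
    linarith

/-- The transformation `e'_i = (k_i+1)·e_i`, `p'_i = (k_i+1)·p_i`,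
`d'_i = k_i·p_i + d_i` with `k_i = ⌊(d_n − d_i)/p_i⌋` preserves `dbf*` at `d_n`, does not
increase `dbf`, forces `d'_i + p'_i > d_n`, keeps `d'_n = d_n`, and preserves `p_i − d_i`
(hence constrained deadlines). -/
theorem stmt12 (n : ℕ) (hn : 0 < n) (e d p : ℕ → ℝ)
    (hpos : ∀ i ∈ Finset.Icc 1 n, 0 < e i ∧ 0 < d i ∧ 0 < p i)
    (hcd : ∀ i ∈ Finset.Icc 1 n, d i ≤ p i)
    (hmono : ∀ i ∈ Finset.Icc 1 n, ∀ j ∈ Finset.Icc 1 n, i ≤ j → d i ≤ d j)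
    (e' d' p' : ℕ → ℝ)
    (he' : ∀ i ∈ Finset.Icc 1 n, e' i = ((⌊(d n - d i) / p i⌋ : ℝ) + 1) * e i)
    (hp' : ∀ i ∈ Finset.Icc 1 n, p' i = ((⌊(d n - d i) / p i⌋ : ℝ) + 1) * p i)
    (hd' : ∀ i ∈ Finset.Icc 1 n, d' i = (⌊(d n - d i) / p i⌋ : ℝ) * p i + d i) :
    (∑ i ∈ Finset.Icc 1 n, dbfStar (e' i) (d' i) (p' i) (d n) =
      ∑ i ∈ Finset.Icc 1 n, dbfStar (e i) (d i) (p i) (d n)) ∧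
    (∀ t : ℝ, 0 < t →
      ∑ i ∈ Finset.Icc 1 n, dbf (e' i) (d' i) (p' i) t ≤
        ∑ i ∈ Finset.Icc 1 n, dbf (e i) (d i) (p i) t) ∧
    (∀ i ∈ Finset.Icc 1 n, d' i + p' i > d n) ∧
    (d' n = d n) ∧
    (∀ i ∈ Finset.Icc 1 n, p' i - d' i = p i - d i ∧ d' i ≤ p' i) := by
  have hn_mem : n ∈ Finset.Icc 1 n := Finset.mem_Icc.2 ⟨hn, le_rfl⟩
  have hk : ∀ i ∈ Finset.Icc 1 n, 0 ≤ ⌊(d n - d i) / p i⌋ := fun i hi =>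
    Int.floor_nonneg.2 (div_nonneg
      (sub_nonneg.2 (hmono i hi n hn_mem (Finset.mem_Icc.1 hi).2)) (hpos i hi).2.2.le)
  have hk' : ∀ i ∈ Finset.Icc 1 n, (0 : ℝ) ≤ ⌊(d n - d i) / p i⌋ := fun i hi => by
    exact_mod_cast hk i hi
  refine ⟨Finset.sum_congr rfl fun i hi => ?_, fun t _ => Finset.sum_le_sum fun i hi => ?_,
    fun i hi => ?_, ?_, fun i hi => ?_⟩
  · rw [he' i hi, hd' i hi, hp' i hi]
    have hp := (hpos i hi).2.2
    have hle := (le_div_iff₀ hp).1 (Int.floor_le ((d n - d i) / p i))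
    exact dbfStar_merge hp (hk' i hi) (by linarith)
  · rw [he' i hi, hd' i hi, hp' i hi]
    exact dbf_merge_le (hpos i hi).1.le (hpos i hi).2.2 (hk i hi) t
  · rw [hd' i hi, hp' i hi]
    have hp := (hpos i hi).2.2
    have hlt := (div_lt_iff₀ hp).1 (Int.lt_floor_add_one ((d n - d i) / p i))
    have hkp := mul_nonneg (hk' i hi) hp.le
    linarith
  · simp [hd' n hn_mem]
  · have hdiff : p' i - d' i = p i - d i := by
      rw [hd' i hi, hp' i hi]
      ring
    exact ⟨hdiff, by linarith [hcd i hi]⟩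
end

section
/- Let (e,d,p) be a task with positive real parameters and e ≤ d, let k be a positive integer, and set δ := e/k. For 1 ≤ j ≤ k define the subtask τ'_j := (δ, d − e + j·δ, p + e − j·δ). Then for every real t ≥ d, ∑_{j=1}^k dbf(τ'_j, t) ≤ dbf((e,d,p), t). -/
open Finset

/-- Adding `s ≥ 0` to numerator and denominator of a nonnegative fraction does not increase its
integer part. -/
theorem floor_add_div_add_le {x p s : ℝ} (hx : 0 ≤ x) (hp : 0 < p) (hs : 0 ≤ s) :
    ⌊(x + s) / (p + s)⌋ ≤ ⌊x / p⌋ := by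
  have hps : 0 < p + s := by linarith
  rcases le_or_gt p x with h | h
  · apply Int.floor_le_floor
    rw [div_le_div_iff₀ hps hp]
    nlinarith [mul_le_mul_of_nonneg_right h hs]
  · have h₁ : ⌊(x + s) / (p + s)⌋ < 1 := by
      rw [Int.floor_lt, Int.cast_one, div_lt_one hps]
      linarith
    have h₂ : 0 ≤ ⌊x / p⌋ := Int.floor_nonneg.mpr (by positivity)
    omega

/-- Splitting a task `(e,d,p)` (with `e ≤ d`) into `k` subtasks
`τ'_j = (δ, d − e + j·δ, p + e − j·δ)` with `δ = e/k` does not increase the demand bound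
function at any `t ≥ d`. -/
theorem stmt14 (e d p : ℝ) (he : 0 < e) (hd : 0 < d) (hp : 0 < p) (hed : e ≤ d)
    (k : ℕ) (hk : 0 < k) (t : ℝ) (ht : d ≤ t) :
    ∑ j ∈ Finset.Icc 1 k,
        dbf (e / k) (d - e + (j : ℝ) * (e / k)) (p + e - (j : ℝ) * (e / k)) t ≤
      dbf e d p t := by
  have hk' : (0 : ℝ) < k := by exact_mod_cast hk
  have hterm : ∀ j ∈ Finset.Icc 1 k,
      dbf (e / k) (d - e + (j : ℝ) * (e / k)) (p + e - (j : ℝ) * (e / k)) t ≤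
        ((⌊(t - d) / p⌋ : ℝ) + 1) * (e / k) := by
    intro j hj
    have hjk : (j : ℝ) ≤ k := by exact_mod_cast (Finset.mem_Icc.mp hj).2
    have hs : 0 ≤ e - j * (e / k) := by
      have h := mul_le_mul_of_nonneg_right hjk (div_pos he hk').le
      rw [mul_div_cancel₀ e hk'.ne'] at h
      linarith
    have hfloor := floor_add_div_add_le (sub_nonneg.mpr ht) hp hs
    rw [dbf, if_neg (by linarith),
      show t - (d - e + j * (e / k)) = t - d + (e - j * (e / k)) by ring, add_sub_assoc]
    gcongr
  refine (Finset.sum_le_sum hterm).trans_eq ?_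
  rw [dbf, if_neg (not_lt.mpr ht), Finset.sum_const, Nat.card_Icc, nsmul_eq_mul,
    Nat.add_sub_cancel]
  field_simp
end

section
/- Let (e,d,p) be a task with positive real parameters and e ≤ d, let k be a positive integer, and set δ := e/k. For 1 ≤ j ≤ k define the subtask τ'_j := (δ, d − e + j·δ, p + e − j·δ). Then for every real D with d ≤ D < d + p, ∑_{j=1}^k dbf*(τ'_j, D) ≥ dbf*((e,d,p), D). -/
open Finset

/-- Decreasing the deadline and increasing the period by the same `x ≥ 0` does not decrease
the approximate demand bound function on `[d, d + p]`. -/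
theorem dbfStar_le_dbfStar_sub_add {e d p t x : ℝ} (he : 0 ≤ e) (hp : 0 < p) (hx : 0 ≤ x)
    (h1 : d ≤ t) (h2 : t ≤ d + p) : dbfStar e d p t ≤ dbfStar e (d - x) (p + x) t := by
  have hdiv : (t - d) / p ≤ (t - (d - x)) / (p + x) := by
    rw [div_le_div_iff₀ hp (by linarith)]
    nlinarith [mul_nonneg hx (show 0 ≤ p - (t - d) by linarith)]
  rw [dbfStar, dbfStar, if_neg h1.not_gt, if_neg (by linarith)]
  gcongr

/-- The approximate demand bound function is linear in the execution time. -/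
theorem nsmul_dbfStar_div (e d p t : ℝ) {k : ℕ} (hk : k ≠ 0) :
    k • dbfStar (e / k) d p t = dbfStar e d p t := by
  unfold dbfStar
  split_ifs
  · simp
  · rw [nsmul_eq_mul]
    field_simp

/-- Splitting a task `(e,d,p)` (with `e ≤ d`) into `k` subtasks
`τ'_j = (δ, d − e + j·δ, p + e − j·δ)` with `δ = e/k` does not decrease the approximate
demand bound function at any `D` with `d ≤ D < d + p`. -/
theorem stmt15 (e d p : ℝ) (he : 0 < e) (hd : 0 < d) (hp : 0 < p) (hed : e ≤ d)
    (k : ℕ) (hk : 0 < k) (D : ℝ) (hD1 : d ≤ D) (hD2 : D < d + p) :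
    ∑ j ∈ Finset.Icc 1 k,
        dbfStar (e / k) (d - e + (j : ℝ) * (e / k)) (p + e - (j : ℝ) * (e / k)) D ≥
      dbfStar e d p D := by
  have hk0 : (0 : ℝ) < k := by exact_mod_cast hk
  calc dbfStar e d p D
      = ∑ _j ∈ Finset.Icc 1 k, dbfStar (e / k) d p D := by
        rw [Finset.sum_const, Nat.card_Icc, Nat.add_sub_cancel, nsmul_dbfStar_div _ _ _ _ hk.ne']
    _ ≤ _ := Finset.sum_le_sum fun j hj => by
        have hjk : (j : ℝ) ≤ k := by exact_mod_cast (Finset.mem_Icc.mp hj).2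
        have hx : 0 ≤ e - j * (e / k) := by
          have := mul_le_mul_of_nonneg_right hjk (div_pos he hk0).le
          rw [mul_div_cancel₀ e hk0.ne'] at this
          linarith
        rw [sub_add, add_sub_assoc]
        exact dbfStar_le_dbfStar_sub_add (div_pos he hk0).le hp hx hD1 hD2.le
end
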